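/- There exists a universal constant K > 0 such that the following holds. Let n ≥ 1, let d be an integer with 1 ≤ d ≤ n, let γ ∈ (0,1], and let f : {-1,1}^n → {-1,1} satisfy Σ_{S : |S| ≤ d} f̂(S)² ≤ γ. Then for every real τ > e^d·√γ, setting δ = exp(−K·(τ²/γ)^{1/d}), the function f is (2τ + δ + 2δ·n^{2d+2})-approximately d-resilient. -/

import Mathlib

open Finset

noncomputable section

/-- The value `±1` of a bit, with `true ↦ 1` and `false ↦ -1`. -/
def sgn (b : Bool) : ℝ := if b then 1 else -1

/-- Expectation of `f` over a uniformly random point of the hypercube `{-1,1}^ι`. -/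
def expect {ι : Type*} [Fintype ι] [DecidableEq ι] (f : (ι → Bool) → ℝ) : ℝ :=
  (∑ x : ι → Bool, f x) / 2 ^ (Fintype.card ι)

/-- Fourier coefficient `ĝ(S) = E[g(x) ∏_{i ∈ S} x_i]`. -/
def fcoef {ι : Type*} [Fintype ι] [DecidableEq ι] (g : (ι → Bool) → ℝ) (S : Finset ι) : ℝ :=
  expect (fun x => g x * ∏ i ∈ S, sgn (x i))

/-- `g` is `d`-resilient if all its Fourier coefficients of degree at most `d` vanish. -/
def Resilient {ι : Type*} [Fintype ι] [DecidableEq ι] (d : ℕ) (g : (ι → Bool) → ℝ) : Prop :=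
  ∀ S : Finset ι, S.card ≤ d → fcoef g S = 0

/-- `f` is Boolean-valued (takes values in `{-1,1}`). -/
def IsBooleanValued {ι : Type*} (f : (ι → Bool) → ℝ) : Prop := ∀ x, f x = 1 ∨ f x = -1

/-- `g` is bounded (takes values in `[-1,1]`). -/
def IsBounded {ι : Type*} (g : (ι → Bool) → ℝ) : Prop := ∀ x, |g x| ≤ 1

/-- `f` is `α`-approximately `d`-resilient: `f` is `α`-close in `ℓ₁` to a bounded
`d`-resilient function. -/
def ApproxResilient {ι : Type*} [Fintype ι] [DecidableEq ι] (α : ℝ) (d : ℕ)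
    (f : (ι → Bool) → ℝ) : Prop :=
  ∃ g : (ι → Bool) → ℝ, Resilient d g ∧ IsBounded g ∧ expect (fun x => |f x - g x|) ≤ α

section

variable {ι : Type*}

/-- The Walsh character `∏_{i ∈ S} x_i`. -/
def walsh (S : Finset ι) (x : ι → Bool) : ℝ := ∏ i ∈ S, sgn (x i)

lemma sgn_mul_self (b : Bool) : sgn b * sgn b = 1 := by cases b <;> simp [sgn]

lemma sgn_sq (b : Bool) : sgn b ^ 2 = 1 := by rw [pow_two, sgn_mul_self]

lemma sgn_not (b : Bool) : sgn (!b) = -sgn b := by cases b <;> simp [sgn]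

lemma walsh_mul_self (S : Finset ι) (x : ι → Bool) : walsh S x * walsh S x = 1 := by
  rw [walsh, ← Finset.prod_mul_distrib]
  exact Finset.prod_eq_one fun i _ => sgn_mul_self _

lemma abs_walsh (S : Finset ι) (x : ι → Bool) : |walsh S x| = 1 := by
  have h := walsh_mul_self S x
  rw [← abs_mul_abs_self] at h
  nlinarith [abs_nonneg (walsh S x)]

variable [DecidableEq ι]

/-- Flip the `i`-th bit. -/
def flipBit (i : ι) (x : ι → Bool) : ι → Bool := Function.update x i (!x i)

lemma flipBit_involutive (i : ι) : Function.Involutive (flipBit i) := by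
  intro x
  ext j
  by_cases h : j = i
  · subst h; simp [flipBit]
  · simp [flipBit, h]

lemma sgn_flipBit_self (i : ι) (x : ι → Bool) : sgn (flipBit i x i) = -sgn (x i) := by
  simp [flipBit, sgn_not]

lemma walsh_flipBit_of_notMem {i : ι} {S : Finset ι} (hi : i ∉ S) (x : ι → Bool) :
    walsh S (flipBit i x) = walsh S x := by
  refine Finset.prod_congr rfl fun j hj => ?_
  have : j ≠ i := by rintro rfl; exact hi hj
  simp [flipBit, this]

lemma walsh_insert {i : ι} {S : Finset ι} (hi : i ∉ S) (x : ι → Bool) :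
    walsh (insert i S) x = sgn (x i) * walsh S x := Finset.prod_insert hi

lemma walsh_flipBit_of_mem {i : ι} {S : Finset ι} (hi : i ∈ S) (x : ι → Bool) :
    walsh S (flipBit i x) = -walsh S x := by
  rw [← Finset.insert_erase hi, walsh_insert (Finset.notMem_erase i S),
    walsh_insert (Finset.notMem_erase i S), walsh_flipBit_of_notMem (Finset.notMem_erase i S),
    sgn_flipBit_self, neg_mul]

variable [Fintype ι]

lemma cubeExpect_flipBit (i : ι) (F : (ι → Bool) → ℝ) :
    _root_.expect (fun x => F (flipBit i x)) = _root_.expect F := by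
  unfold _root_.expect
  rw [(flipBit_involutive i).bijective.sum_comp F]

lemma cubeExpect_add (F G : (ι → Bool) → ℝ) :
    _root_.expect (fun x => F x + G x) = _root_.expect F + _root_.expect G := by
  simp only [_root_.expect, Finset.sum_add_distrib, add_div]

lemma cubeExpect_const_mul (c : ℝ) (F : (ι → Bool) → ℝ) :
    _root_.expect (fun x => c * F x) = c * _root_.expect F := by
  simp only [_root_.expect, ← Finset.mul_sum, mul_div_assoc]

lemma cubeExpect_sum {κ : Type*} (s : Finset κ) (F : κ → (ι → Bool) → ℝ) :
    _root_.expect (fun x => ∑ k ∈ s, F k x) = ∑ k ∈ s, _root_.expect (F k) := by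
  simp only [_root_.expect, ← Finset.sum_div]
  rw [Finset.sum_comm]

lemma cubeExpect_mono {F G : (ι → Bool) → ℝ} (h : ∀ x, F x ≤ G x) :
    _root_.expect F ≤ _root_.expect G := by
  unfold _root_.expect
  gcongr
  exact h _

lemma cubeExpect_const (c : ℝ) : _root_.expect (fun _ : ι → Bool => c) = c := by
  simp [_root_.expect]

lemma abs_cubeExpect_le (F : (ι → Bool) → ℝ) :
    |_root_.expect F| ≤ _root_.expect (fun x => |F x|) := by
  unfold _root_.expect
  rw [abs_div, abs_of_pos (by positivity : (0 : ℝ) < 2 ^ Fintype.card ι)]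
  gcongr
  exact Finset.abs_sum_le_sum_abs _ _

lemma cubeExpect_walsh_mul_walsh (S T : Finset ι) :
    _root_.expect (fun x => walsh S x * walsh T x) = if S = T then 1 else 0 := by
  split_ifs with h
  · subst h
    simp only [walsh_mul_self, cubeExpect_const]
  · obtain ⟨i, hi⟩ : ∃ i, ¬(i ∈ S ↔ i ∈ T) := by
      by_contra! hc
      exact h (Finset.ext hc)
    have key := cubeExpect_flipBit i (fun x => walsh S x * walsh T x)
    have hneg : (fun x => walsh S (flipBit i x) * walsh T (flipBit i x))
        = fun x => (-1) * (walsh S x * walsh T x) := by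
      funext x
      by_cases hS : i ∈ S
      · have hT : i ∉ T := fun hT => hi ⟨fun _ => hT, fun _ => hS⟩
        rw [walsh_flipBit_of_mem hS, walsh_flipBit_of_notMem hT]; ring
      · have hT : i ∈ T := by by_contra hT; exact hi ⟨fun h => (hS h).elim, fun h => (hT h).elim⟩
        rw [walsh_flipBit_of_notMem hS, walsh_flipBit_of_mem hT]; ring
    rw [hneg, cubeExpect_const_mul] at key
    linarith

lemma fcoef_eq (g : (ι → Bool) → ℝ) (S : Finset ι) :
    fcoef g S = _root_.expect (fun x => g x * walsh S x) := rfl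

lemma fcoef_add (g h : (ι → Bool) → ℝ) (S : Finset ι) :
    fcoef (fun x => g x + h x) S = fcoef g S + fcoef h S := by
  simp only [fcoef_eq, add_mul, cubeExpect_add]

lemma fcoef_const_mul (c : ℝ) (g : (ι → Bool) → ℝ) (S : Finset ι) :
    fcoef (fun x => c * g x) S = c * fcoef g S := by
  simp only [fcoef_eq, mul_assoc, cubeExpect_const_mul]

lemma fcoef_sub (g h : (ι → Bool) → ℝ) (S : Finset ι) :
    fcoef (fun x => g x - h x) S = fcoef g S - fcoef h S := by
  have := fcoef_add g (fun x => (-1) * h x) S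
  rw [fcoef_const_mul] at this
  rw [sub_eq_add_neg, ← neg_one_mul, ← this]
  congr 1
  funext x
  ring

lemma fcoef_sum_walsh (A : Finset (Finset ι)) (c : Finset ι → ℝ) {S : Finset ι} (hS : S ∈ A) :
    fcoef (fun x => ∑ T ∈ A, c T * walsh T x) S = c S := by
  simp only [fcoef_eq, Finset.sum_mul, mul_assoc]
  rw [cubeExpect_sum]
  simp only [cubeExpect_const_mul, cubeExpect_walsh_mul_walsh]
  simp [hS]

lemma abs_fcoef_le (g : (ι → Bool) → ℝ) (S : Finset ι) :
    |fcoef g S| ≤ _root_.expect (fun x => |g x|) := by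
  rw [fcoef_eq]
  refine (abs_cubeExpect_le _).trans (le_of_eq ?_)
  simp only [abs_mul, abs_walsh, mul_one]

lemma choose_two_mul_le (k j : ℕ) :
    (2 * k).choose (2 * j) ≤ k.choose j * (2 * k - 1) ^ j := by
  induction j with
  | zero => simp
  | succ j ih =>
    rcases Nat.lt_or_ge j k with hjk | hjk
    · obtain ⟨m, rfl⟩ : ∃ m, k = j + 1 + m := ⟨k - (j + 1), by omega⟩
      have e1 := Nat.choose_succ_right_eq (2 * (j + 1 + m)) (2 * j)
      have e2 := Nat.choose_succ_right_eq (2 * (j + 1 + m)) (2 * j + 1)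
      have e3 := Nat.choose_succ_right_eq (j + 1 + m) j
      rw [show 2 * (j + 1 + m) - 2 * j = 2 * (m + 1) by omega] at e1
      rw [show 2 * (j + 1 + m) - (2 * j + 1) = 2 * m + 1 by omega] at e2
      rw [show j + 1 + m - j = m + 1 by omega] at e3
      rw [show 2 * (j + 1) = 2 * j + 1 + 1 by ring, pow_succ]
      set q := 2 * (j + 1 + m) - 1 with hq
      have hq' : 2 * m + 1 ≤ q := by omega
      set a := (2 * (j + 1 + m)).choose (2 * j)
      set b := (2 * (j + 1 + m)).choose (2 * j + 1)
      set c := (2 * (j + 1 + m)).choose (2 * j + 1 + 1)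
      set p := (j + 1 + m).choose j
      set r := (j + 1 + m).choose (j + 1)
      have h1 : c * ((2 * j + 1) * (2 * j + 2)) = a * (2 * (m + 1)) * (2 * m + 1) := by
        rw [← e1, show c * ((2 * j + 1) * (2 * j + 2)) = (c * (2 * j + 1 + 1)) * (2 * j + 1) by ring,
          e2]
        ring
      have h2 : a * (2 * (m + 1)) * (2 * m + 1) ≤ (p * q ^ j) * (2 * (m + 1)) * q := by gcongr
      have h3 : (p * q ^ j) * (2 * (m + 1)) * q = (r * (q ^ j * q)) * (2 * j + 2) := by
        rw [show (p * q ^ j) * (2 * (m + 1)) * q = (p * (m + 1)) * (2 * q ^ j * q) by ring, ← e3]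
        ring
      have h4 : c * (2 * j + 2) ≤ (r * (q ^ j * q)) * (2 * j + 2) := by
        rw [← h3]
        refine le_trans ?_ h2
        rw [← h1]
        gcongr
        exact Nat.le_mul_of_pos_left _ (by omega)
      exact Nat.le_of_mul_le_mul_right h4 (by omega)
    · rw [Nat.choose_eq_zero_of_lt (by omega)]
      exact Nat.zero_le _

lemma sum_range_two_mul_succ {M : Type*} [AddCommMonoid M] (F : ℕ → M) (k : ℕ) :
    ∑ m ∈ range (2 * k + 1), F m
      = ∑ j ∈ range (k + 1), F (2 * j) + ∑ j ∈ range k, F (2 * j + 1) := by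
  induction k with
  | zero => simp
  | succ k ih =>
    rw [show 2 * (k + 1) + 1 = 2 * k + 1 + 1 + 1 by ring, Finset.sum_range_succ,
      Finset.sum_range_succ, ih, Finset.sum_range_succ _ (k + 1), Finset.sum_range_succ _ k,
      show 2 * (k + 1) = 2 * k + 1 + 1 by ring]
    rw [Finset.sum_range_succ (fun j => F (2 * j + 1)) k]
    abel

lemma two_point_inequality (k : ℕ) (v w : ℝ) :
    ((v + w) ^ (2 * k) + (v - w) ^ (2 * k)) / 2 ≤ (v ^ 2 + (2 * k - 1 : ℕ) * w ^ 2) ^ k := by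
  have h : ((v + w) ^ (2 * k) + (v - w) ^ (2 * k)) / 2
      = ∑ j ∈ range (k + 1), (w ^ 2) ^ j * (v ^ 2) ^ (k - j) * ((2 * k).choose (2 * j) : ℕ) := by
    rw [add_comm v w, sub_eq_neg_add, add_pow, add_pow, ← Finset.sum_add_distrib,
      sum_range_two_mul_succ]
    have hodd : ∑ j ∈ range k, (w ^ (2 * j + 1) * v ^ (2 * k - (2 * j + 1))
        * ((2 * k).choose (2 * j + 1) : ℝ) + (-w) ^ (2 * j + 1) * v ^ (2 * k - (2 * j + 1))
        * ((2 * k).choose (2 * j + 1) : ℝ)) = 0 := by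
      refine Finset.sum_eq_zero fun j _ => ?_
      rw [Odd.neg_pow ⟨j, rfl⟩]
      ring
    rw [hodd, add_zero, Finset.sum_div]
    refine Finset.sum_congr rfl fun j _ => ?_
    rw [Even.neg_pow ⟨j, by ring⟩, ← pow_mul, ← pow_mul, Nat.mul_sub]
    ring
  rw [h, add_comm (v ^ 2), add_pow]
  refine Finset.sum_le_sum fun j _ => ?_
  have hc : (((2 * k).choose (2 * j) : ℕ) : ℝ) ≤ k.choose j * ((2 * k - 1 : ℕ) : ℝ) ^ j := by
    exact_mod_cast choose_two_mul_le k j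
  calc (w ^ 2) ^ j * (v ^ 2) ^ (k - j) * ((2 * k).choose (2 * j) : ℕ)
      ≤ (w ^ 2) ^ j * (v ^ 2) ^ (k - j) * (k.choose j * ((2 * k - 1 : ℕ) : ℝ) ^ j) := by gcongr
    _ = _ := by rw [mul_pow]; ring

lemma cubeExpect_add_pow_le {k : ℕ} (hk : 1 ≤ k) {F G : (ι → Bool) → ℝ} (hF : ∀ x, 0 ≤ F x)
    (hG : ∀ x, 0 ≤ G x) {a b : ℝ} (ha : 0 ≤ a) (hb : 0 ≤ b)
    (hFa : _root_.expect (fun x => F x ^ k) ≤ a ^ k)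
    (hGb : _root_.expect (fun x => G x ^ k) ≤ b ^ k) :
    _root_.expect (fun x => (F x + G x) ^ k) ≤ (a + b) ^ k := by
  have hk1 : (1 : ℝ) ≤ k := by exact_mod_cast hk
  have hk0 : k ≠ 0 := by omega
  have key := Real.Lp_add_le_of_nonneg (s := Finset.univ) (f := F) (g := G) hk1
    (fun x _ => hF x) (fun x _ => hG x)
  simp only [Real.rpow_natCast, one_div] at key
  set N : ℝ := 2 ^ Fintype.card ι with hN
  have hN0 : 0 < N := by positivity
  set r : ℝ := N ^ ((k : ℝ)⁻¹) with hr
  have hr0 : 0 ≤ r := by positivity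
  have hrk : r ^ k = N := Real.rpow_inv_natCast_pow hN0.le hk0
  have bound : ∀ (H : (ι → Bool) → ℝ) (c : ℝ), (∀ x, 0 ≤ H x) → 0 ≤ c →
      _root_.expect (fun x => H x ^ k) ≤ c ^ k → (∑ x, H x ^ k) ^ ((k : ℝ)⁻¹) ≤ r * c := by
    intro H c hH hc h
    unfold _root_.expect at h
    rw [div_le_iff₀ hN0] at h
    have h' : ∑ x, H x ^ k ≤ (r * c) ^ k := by rw [mul_pow, hrk]; linarith
    calc (∑ x, H x ^ k) ^ ((k : ℝ)⁻¹) ≤ ((r * c) ^ k) ^ ((k : ℝ)⁻¹) := by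
          apply Real.rpow_le_rpow (Finset.sum_nonneg fun x _ => pow_nonneg (hH x) k) h'
          positivity
      _ = r * c := Real.pow_rpow_inv_natCast (by positivity) hk0
  have hle : (∑ x, (F x + G x) ^ k) ^ ((k : ℝ)⁻¹) ≤ r * (a + b) := by
    have h1 := bound F a hF ha hFa
    have h2 := bound G b hG hb hGb
    linarith
  have hnn : 0 ≤ ∑ x, (F x + G x) ^ k :=
    Finset.sum_nonneg fun x _ => pow_nonneg (add_nonneg (hF x) (hG x)) k
  have h3 := pow_le_pow_left₀ (Real.rpow_nonneg hnn _) hle k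
  rw [Real.rpow_inv_natCast_pow hnn hk0, mul_pow, hrk] at h3
  unfold _root_.expect
  rw [div_le_iff₀ hN0]
  linarith

/-- The `(2, 2k)`-hypercontractive inequality on the hypercube. -/
lemma cubeExpect_pow_le_hypercontractive {k : ℕ} (hk : 1 ≤ k) (T : Finset ι) (c : Finset ι → ℝ) :
    _root_.expect (fun x => (∑ S ∈ T.powerset, c S * walsh S x) ^ (2 * k))
      ≤ (∑ S ∈ T.powerset, ((2 * k - 1 : ℕ) : ℝ) ^ S.card * c S ^ 2) ^ k := by
  induction T using Finset.induction_on generalizing c with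
  | empty => simp [walsh, cubeExpect_const, pow_mul]
  | insert i T hi ih =>
    set q : ℝ := ((2 * k - 1 : ℕ) : ℝ) with hq
    have hq0 : 0 ≤ q := Nat.cast_nonneg _
    set v : (ι → Bool) → ℝ := fun x => ∑ S ∈ T.powerset, c S * walsh S x with hv
    set u : (ι → Bool) → ℝ := fun x => ∑ S ∈ T.powerset, c (insert i S) * walsh S x with hu
    have hnot : ∀ S ∈ T.powerset, i ∉ S := fun S hS h => hi (Finset.mem_powerset.1 hS h)
    have hsplit : ∀ x, ∑ S ∈ (insert i T).powerset, c S * walsh S x = v x + sgn (x i) * u x := by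
      intro x
      rw [Finset.sum_powerset_insert hi, hv, hu, Finset.mul_sum]
      congr 1
      refine Finset.sum_congr rfl fun S hS => ?_
      rw [walsh_insert (hnot S hS)]
      ring
    have hvf : ∀ x, v (flipBit i x) = v x := fun x =>
      Finset.sum_congr rfl fun S hS => by rw [walsh_flipBit_of_notMem (hnot S hS)]
    have huf : ∀ x, u (flipBit i x) = u x := fun x =>
      Finset.sum_congr rfl fun S hS => by rw [walsh_flipBit_of_notMem (hnot S hS)]
    have hcoef : ∑ S ∈ (insert i T).powerset, q ^ S.card * c S ^ 2
        = ∑ S ∈ T.powerset, q ^ S.card * c S ^ 2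
          + q * ∑ S ∈ T.powerset, q ^ S.card * c (insert i S) ^ 2 := by
      rw [Finset.sum_powerset_insert hi, Finset.mul_sum]
      congr 1
      refine Finset.sum_congr rfl fun S hS => ?_
      rw [Finset.card_insert_of_notMem (hnot S hS)]
      ring
    simp only [hsplit]
    rw [hcoef]
    have hsymm : _root_.expect (fun x => (v x + sgn (x i) * u x) ^ (2 * k))
        = _root_.expect (fun x => ((v x + sgn (x i) * u x) ^ (2 * k)
            + (v x - sgn (x i) * u x) ^ (2 * k)) / 2) := by
      have h1 := cubeExpect_flipBit i (fun x => (v x + sgn (x i) * u x) ^ (2 * k))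
      simp only [hvf, huf, sgn_flipBit_self, neg_mul, ← sub_eq_add_neg] at h1
      have h2 : (fun x => ((v x + sgn (x i) * u x) ^ (2 * k)
            + (v x - sgn (x i) * u x) ^ (2 * k)) / 2)
          = fun x => (1 / 2) * ((v x + sgn (x i) * u x) ^ (2 * k)
            + (v x - sgn (x i) * u x) ^ (2 * k)) := by
        funext x; ring
      rw [h2, cubeExpect_const_mul, cubeExpect_add, h1]
      ring
    rw [hsymm]
    have hpt : ∀ x, ((v x + sgn (x i) * u x) ^ (2 * k) + (v x - sgn (x i) * u x) ^ (2 * k)) / 2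
        ≤ (v x ^ 2 + q * u x ^ 2) ^ k := by
      intro x
      have := two_point_inequality k (v x) (sgn (x i) * u x)
      rwa [mul_pow (sgn (x i)) (u x) 2, sgn_sq, one_mul] at this
    refine (cubeExpect_mono hpt).trans ?_
    have hS0 : ∀ c' : Finset ι → ℝ, 0 ≤ ∑ S ∈ T.powerset, q ^ S.card * c' S ^ 2 :=
      fun c' => Finset.sum_nonneg fun S _ => by positivity
    refine cubeExpect_add_pow_le hk (fun x => sq_nonneg _) (fun x => by positivity) (hS0 c)
      (mul_nonneg hq0 (hS0 fun S => c (insert i S))) ?_ ?_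
    · simpa only [← pow_mul] using ih c
    · simp only [mul_pow, cubeExpect_const_mul]
      gcongr
      simpa only [← pow_mul] using ih fun S => c (insert i S)

lemma cubeExpect_lowDegree_pow_le {k : ℕ} (hk : 1 ≤ k) (d : ℕ) (c : Finset ι → ℝ) :
    _root_.expect (fun x =>
        (∑ S ∈ univ.filter (fun S : Finset ι => S.card ≤ d), c S * walsh S x) ^ (2 * k))
      ≤ (((2 * k - 1 : ℕ) : ℝ) ^ d
          * ∑ S ∈ univ.filter (fun S : Finset ι => S.card ≤ d), c S ^ 2) ^ k := by
  have hq1 : (1 : ℝ) ≤ ((2 * k - 1 : ℕ) : ℝ) := by exact_mod_cast (by omega : 1 ≤ 2 * k - 1)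
  have h := cubeExpect_pow_le_hypercontractive hk (univ : Finset ι)
    (fun S => if S.card ≤ d then c S else 0)
  simp only [Finset.powerset_univ, ite_mul, zero_mul, ← Finset.sum_filter] at h
  refine h.trans (pow_le_pow_left₀ (Finset.sum_nonneg fun S _ => by positivity) ?_ k)
  rw [Finset.mul_sum, Finset.sum_filter]
  refine Finset.sum_le_sum fun S _ => ?_
  split_ifs with hS
  · gcongr
  · simp

lemma card_lowDegree_le (n d : ℕ) :
    (univ.filter (fun S : Finset (Fin n) => S.card ≤ d)).card ≤ (n + 1) ^ d := by
  have hmaps : ∀ S ∈ univ.filter (fun S : Finset (Fin n) => S.card ≤ d), S.card ∈ range (d + 1) :=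
    fun S hS => Finset.mem_range.2 (Nat.lt_succ_of_le (Finset.mem_filter.1 hS).2)
  rw [Finset.card_eq_sum_card_fiberwise hmaps, add_pow]
  refine Finset.sum_le_sum fun k hk => ?_
  calc _ ≤ (Finset.powersetCard k (univ : Finset (Fin n))).card := by
        refine Finset.card_le_card fun S hS => ?_
        exact Finset.mem_powersetCard.2 ⟨Finset.subset_univ _, (Finset.mem_filter.1 hS).2⟩
    _ = n.choose k := by simp
    _ ≤ n ^ k := Nat.choose_le_pow n k
    _ ≤ n ^ k * 1 ^ (d - k) * d.choose k := by
        rw [one_pow, mul_one]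
        exact Nat.le_mul_of_pos_right _
          (Nat.choose_pos (Nat.lt_succ_iff.1 (Finset.mem_range.1 hk)))

lemma succ_pow_le_two_mul_pow {n d : ℕ} (hd : 1 ≤ d) (hdn : d ≤ n) :
    (n + 1) ^ d ≤ 2 * n ^ (2 * d + 2) := by
  rcases Nat.lt_or_ge n 2 with h | h
  · obtain rfl : n = 1 := by omega
    obtain rfl : d = 1 := by omega
    norm_num
  · calc (n + 1) ^ d ≤ (n ^ 2) ^ d := by gcongr; nlinarith
      _ = n ^ (2 * d) := by rw [← pow_mul]
      _ ≤ n ^ (2 * d + 2) := Nat.pow_le_pow_right (by omega) (by omega)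
      _ ≤ 2 * n ^ (2 * d + 2) := Nat.le_mul_of_pos_left _ (by norm_num)

/-- The part of the low-degree projection of `f` where it exceeds `τ` in absolute value
controls the approximate resilience of `f`. -/
lemma approxResilient_of_tail (d : ℕ) {f : (ι → Bool) → ℝ} (hf : IsBounded f) {τ ε : ℝ}
    (hτ : 0 ≤ τ)
    (hε : _root_.expect (fun x =>
        if τ < |∑ S ∈ univ.filter (fun S : Finset ι => S.card ≤ d), fcoef f S * walsh S x|
        then |∑ S ∈ univ.filter (fun S : Finset ι => S.card ≤ d), fcoef f S * walsh S x|
        else 0) ≤ ε) :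
    ApproxResilient
      (2 * τ + 2 * ((univ.filter (fun S : Finset ι => S.card ≤ d)).card * ε)) d f := by
  set A := univ.filter (fun S : Finset ι => S.card ≤ d) with hA
  set h : (ι → Bool) → ℝ := fun x => ∑ S ∈ A, fcoef f S * walsh S x with hh
  set r : (ι → Bool) → ℝ := fun x => if τ < |h x| then h x else 0 with hr
  set p : (ι → Bool) → ℝ := fun x => ∑ S ∈ A, fcoef r S * walsh S x with hp
  have hrε : _root_.expect (fun x => |r x|) ≤ ε := by
    refine (le_of_eq ?_).trans hε
    congr 1
    funext x
    simp only [hr, apply_ite abs, abs_zero]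
    rfl
  have hε0 : 0 ≤ ε := by
    refine le_trans ?_ hrε
    have := cubeExpect_mono (F := fun _ : ι → Bool => (0 : ℝ)) fun x => abs_nonneg (r x)
    rwa [cubeExpect_const] at this
  have hpb : ∀ x, |p x| ≤ A.card * ε := by
    intro x
    refine (Finset.abs_sum_le_sum_abs _ _).trans ?_
    rw [← nsmul_eq_mul]
    refine Finset.sum_le_card_nsmul _ _ _ fun S _ => ?_
    rw [abs_mul, abs_walsh, mul_one]
    exact (abs_fcoef_le r S).trans hrε
  have hhr : ∀ x, |h x - r x| ≤ τ := by
    intro x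
    simp only [hr]
    split_ifs with hx
    · simpa using hτ
    · simpa using hx
  set η : ℝ := A.card * ε with hη
  have hη0 : 0 ≤ η := by positivity
  set M : ℝ := 1 + τ + η with hM
  have hM1 : 1 ≤ M := by linarith
  have hM0 : 0 < M := by linarith
  set g : (ι → Bool) → ℝ := fun x => f x - (h x - r x) - p x with hg
  have hfg : ∀ x, |f x - g x| ≤ τ + η := by
    intro x
    have : f x - g x = (h x - r x) + p x := by simp only [hg]; ring
    rw [this]
    exact (abs_add_le _ _).trans (add_le_add (hhr x) (hpb x))
  have hgM : ∀ x, |g x| ≤ M := by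
    intro x
    have h1 := abs_le.1 (hfg x)
    have h2 := abs_le.1 (hf x)
    exact abs_le.2 ⟨by linarith [h1.2, h2.1], by linarith [h1.1, h2.2]⟩
  have hgb : ∀ x, |M⁻¹ * g x| ≤ 1 := by
    intro x
    rw [abs_mul, abs_of_pos (inv_pos.2 hM0), inv_mul_le_iff₀ hM0, mul_one]
    exact hgM x
  refine ⟨fun x => M⁻¹ * g x, ?_, hgb, ?_⟩
  · intro S hS
    have hSA : S ∈ A := by simp [hA, hS]
    rw [fcoef_const_mul, hg, fcoef_sub, fcoef_sub, fcoef_sub, hp, hh, fcoef_sum_walsh A _ hSA,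
      fcoef_sum_walsh A _ hSA]
    ring
  · have hpt : ∀ x, |f x - M⁻¹ * g x| ≤ 2 * τ + 2 * η := by
      intro x
      have h1 : f x - M⁻¹ * g x = (f x - g x) + (M - 1) * (M⁻¹ * g x) := by
        field_simp
        ring
      have h2 : |(M - 1) * (M⁻¹ * g x)| ≤ M - 1 := by
        rw [abs_mul, abs_of_nonneg (by linarith : 0 ≤ M - 1)]
        exact mul_le_of_le_one_right (by linarith) (hgb x)
      rw [h1]
      refine (abs_add_le _ _).trans ?_
      linarith [hfg x]
    refine (cubeExpect_mono hpt).trans (le_of_eq (cubeExpect_const _))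

/-- Tail bound for low-degree polynomials from the moment of order `2k`. -/
lemma cubeExpect_tail_le {k : ℕ} (hk : 1 ≤ k) {d : ℕ} {c : Finset ι → ℝ} {γ τ : ℝ} (hτ : 0 < τ)
    (hc : ∑ S ∈ univ.filter (fun S : Finset ι => S.card ≤ d), c S ^ 2 ≤ γ) :
    _root_.expect (fun x =>
        if τ < |∑ S ∈ univ.filter (fun S : Finset ι => S.card ≤ d), c S * walsh S x|
        then |∑ S ∈ univ.filter (fun S : Finset ι => S.card ≤ d), c S * walsh S x| else 0)
      ≤ τ * (((2 * k - 1 : ℕ) : ℝ) ^ d * γ / τ ^ 2) ^ k := by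
  set h : (ι → Bool) → ℝ :=
    fun x => ∑ S ∈ univ.filter (fun S : Finset ι => S.card ≤ d), c S * walsh S x with hh
  have hpt : ∀ x, (if τ < |h x| then |h x| else 0) ≤ (τ / (τ ^ 2) ^ k) * h x ^ (2 * k) := by
    intro x
    have hpos : 0 ≤ h x ^ (2 * k) := by rw [pow_mul]; positivity
    split_ifs with hx
    · obtain ⟨m, rfl⟩ : ∃ m, k = m + 1 := ⟨k - 1, by omega⟩
      rw [div_mul_eq_mul_div, le_div_iff₀ (by positivity), ← pow_mul, pow_mul (h x),
        ← sq_abs (h x), ← pow_mul, show 2 * (m + 1) = 2 * m + 1 + 1 by ring, pow_succ |h x|,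
        pow_succ τ]
      have : τ ^ (2 * m + 1) ≤ |h x| ^ (2 * m + 1) := pow_le_pow_left₀ hτ.le hx.le _
      have h2 := mul_le_mul_of_nonneg_right this (mul_nonneg hτ.le (abs_nonneg (h x)))
      linarith
    · positivity
  refine (cubeExpect_mono hpt).trans ?_
  rw [cubeExpect_const_mul, div_pow, div_mul_eq_mul_div, mul_div_assoc]
  have hm : _root_.expect (fun x => h x ^ (2 * k)) ≤ (((2 * k - 1 : ℕ) : ℝ) ^ d * γ) ^ k := by
    refine (cubeExpect_lowDegree_pow_le hk d c).trans ?_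
    have h0 : 0 ≤ ∑ S ∈ univ.filter (fun S : Finset ι => S.card ≤ d), c S ^ 2 :=
      Finset.sum_nonneg fun S _ => sq_nonneg _
    gcongr
  gcongr

/-- Choosing the order of the moment optimally gives an exponential tail. -/
lemma exists_moment_bound {d : ℕ} (hd : 1 ≤ d) {γ τ : ℝ} (hγ : 0 < γ) (hτ : τ < 1 / 2)
    (hlarge : Real.exp d * Real.sqrt γ < τ) :
    ∃ k : ℕ, 1 ≤ k ∧ τ * (((2 * k - 1 : ℕ) : ℝ) ^ d * γ / τ ^ 2) ^ k
      ≤ Real.exp (-(1 / 12) * (τ ^ 2 / γ) ^ ((1 : ℝ) / d)) / 2 := by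
  have hd0 : d ≠ 0 := by omega
  have hτ0 : 0 < τ := lt_of_le_of_lt (by positivity) hlarge
  set t : ℝ := (τ ^ 2 / γ) ^ ((1 : ℝ) / d) with ht
  have hbase : 0 < τ ^ 2 / γ := by positivity
  have ht0 : 0 < t := Real.rpow_pos_of_pos hbase _
  have htd : t ^ d = τ ^ 2 / γ := by
    rw [ht, one_div]
    exact Real.rpow_inv_natCast_pow hbase.le hd0
  have ht6 : 6 ≤ t := by
    have h1 : (Real.exp 2) ^ d ≤ t ^ d := by
      rw [htd, le_div_iff₀ hγ, ← Real.exp_nat_mul]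
      have h2 : (Real.exp d * Real.sqrt γ) ^ 2 ≤ τ ^ 2 :=
        pow_le_pow_left₀ (by positivity) hlarge.le 2
      rw [mul_pow, Real.sq_sqrt hγ.le, ← Real.exp_nat_mul] at h2
      rwa [show (d : ℝ) * 2 = (2 : ℕ) * (d : ℝ) by push_cast; ring]
    have h3 : Real.exp 2 ≤ t := le_of_pow_le_pow_left₀ hd0 ht0.le h1
    have h4 : Real.exp 2 = Real.exp 1 * Real.exp 1 := by rw [← Real.exp_add]; norm_num
    nlinarith [Real.exp_one_gt_d9]
  set k : ℕ := ⌊t / 6 + 1 / 2⌋₊ with hk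
  have hk1 : 1 ≤ k := Nat.le_floor (by push_cast; linarith)
  have hkle : (k : ℝ) ≤ t / 6 + 1 / 2 := Nat.floor_le (by positivity)
  have hkge : t / 6 + 1 / 2 < k + 1 := Nat.lt_floor_add_one _
  refine ⟨k, hk1, ?_⟩
  have hq : ((2 * k - 1 : ℕ) : ℝ) ≤ t * Real.exp (-1) := by
    rw [Nat.cast_sub (by omega)]
    push_cast
    have h3 : (1 / 3 : ℝ) ≤ Real.exp (-1) := by
      rw [Real.exp_neg, ← one_div]
      exact one_div_le_one_div_of_le (Real.exp_pos 1) (by linarith [Real.exp_one_lt_d9])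
    nlinarith
  have hratio : ((2 * k - 1 : ℕ) : ℝ) ^ d * γ / τ ^ 2 ≤ Real.exp (-1) := by
    have h1 : ((2 * k - 1 : ℕ) : ℝ) ^ d ≤ t ^ d * Real.exp (-1) := by
      calc ((2 * k - 1 : ℕ) : ℝ) ^ d ≤ (t * Real.exp (-1)) ^ d := by gcongr
        _ = t ^ d * Real.exp (-1) ^ d := mul_pow _ _ _
        _ ≤ t ^ d * Real.exp (-1) := by
          gcongr
          exact pow_le_of_le_one (Real.exp_pos _).le (Real.exp_le_one_iff.2 (by norm_num)) hd0
    rw [htd] at h1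
    rw [div_le_iff₀ (by positivity)]
    calc ((2 * k - 1 : ℕ) : ℝ) ^ d * γ ≤ τ ^ 2 / γ * Real.exp (-1) * γ := by gcongr
      _ = Real.exp (-1) * τ ^ 2 := by field_simp
  calc τ * (((2 * k - 1 : ℕ) : ℝ) ^ d * γ / τ ^ 2) ^ k
      ≤ 1 / 2 * Real.exp (-1) ^ k := by gcongr
    _ = Real.exp (-k) / 2 := by rw [← Real.exp_nat_mul]; ring_nf
    _ ≤ _ := by
      gcongr
      linarith

end

/-- **Low-degree Fourier weight implies approximate resilience.** There is a universal `K > 0`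
such that: if `f : {-1,1}^n → {-1,1}` has Fourier weight at most `γ ∈ (0,1]` on levels `≤ d`
(where `1 ≤ d ≤ n`), then for every `τ > e^d·√γ`, with `δ = exp(−K·(τ²/γ)^{1/d})`, the function
`f` is `(2τ + δ + 2δ·n^{2d+2})`-approximately `d`-resilient. -/
theorem stmt4 :
    ∃ K : ℝ, 0 < K ∧
      ∀ (n d : ℕ), 1 ≤ d → d ≤ n →
      ∀ γ : ℝ, 0 < γ → γ ≤ 1 →
      ∀ f : (Fin n → Bool) → ℝ, IsBooleanValued f →
      (∑ S ∈ Finset.univ.filter (fun S : Finset (Fin n) => S.card ≤ d), fcoef f S ^ 2) ≤ γ →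
      ∀ τ : ℝ, Real.exp d * Real.sqrt γ < τ →
      ApproxResilient
        (2 * τ + Real.exp (-K * (τ ^ 2 / γ) ^ ((1 : ℝ) / d))
          + 2 * Real.exp (-K * (τ ^ 2 / γ) ^ ((1 : ℝ) / d)) * (n : ℝ) ^ (2 * d + 2))
        d f := by
  refine ⟨1 / 12, by norm_num, ?_⟩
  intro n d hd hdn γ hγ _ f hf hweight τ hlarge
  have hτ0 : 0 < τ := lt_of_le_of_lt (by positivity) hlarge
  set δ : ℝ := Real.exp (-(1 / 12) * (τ ^ 2 / γ) ^ ((1 : ℝ) / d)) with hδ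
  have hδ0 : 0 < δ := Real.exp_pos _
  have hfabs : ∀ x, |f x| = 1 := fun x => by rcases hf x with h | h <;> simp [h]
  rcases le_or_gt (1 / 2) τ with hτ | hτ
  · refine ⟨fun _ => 0, fun S _ => by simp [fcoef_eq, cubeExpect_const], fun _ => by simp, ?_⟩
    simp only [sub_zero, hfabs, cubeExpect_const]
    have : 0 ≤ 2 * δ * (n : ℝ) ^ (2 * d + 2) := by positivity
    linarith
  · obtain ⟨k, hk, hkb⟩ := exists_moment_bound hd hγ hτ hlarge
    obtain ⟨g, hg, hgb, hfg⟩ := approxResilient_of_tail d (fun x => (hfabs x).le) hτ0.le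
      ((cubeExpect_tail_le hk hτ0 hweight).trans hkb)
    refine ⟨g, hg, hgb, hfg.trans ?_⟩
    have hcard : ((univ.filter (fun S : Finset (Fin n) => S.card ≤ d)).card : ℝ)
        ≤ 2 * (n : ℝ) ^ (2 * d + 2) := by
      exact_mod_cast (card_lowDegree_le n d).trans (succ_pow_le_two_mul_pow hd hdn)
    have := mul_le_mul_of_nonneg_right hcard hδ0.le
    linarith
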